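/- For every L ≥ 1, with X_L := a Q_L + a† Q_{L−1} (the regularized interaction a_L + a_L†), the first two multiple commutators with a are given by [X_L, a]_1 = a² Π_{L+1} + a a† Π_L − Q_L and [X_L, a]_2 = a³ Π_{L+1} + a² a† (Π_L + Π_{L+1}) − 2 a Π_{L+1} − a (a†)² Π_{L−1}, as linear maps on D. -/

import Mathlib

open Filter Topology
open scoped ENNReal

noncomputable section

/-- The boson Hilbert space `H = ℓ²(ℕ, ℂ)`. -/
abbrev Hb : Type := lp (fun _ : ℕ => ℂ) 2

/-- The standard orthonormal basis vectors `e n` of `H`. -/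
def eb (n : ℕ) : Hb := lp.single 2 n (1 : ℂ)

/-- The dense subspace `D` of finitely supported linear combinations of the `e n`,
modelled as finitely supported sequences. -/
abbrev Db : Type := ℕ →₀ ℂ

/-- The inclusion `D → H`. -/
def incl : Db →ₗ[ℂ] Hb := Finsupp.linearCombination ℂ eb

/-- The annihilation operator `a : D → D`, `a e₀ = 0`, `a eₙ = √n e_{n-1}`. -/
def aOp : Db →ₗ[ℂ] Db :=
  Finsupp.lsum ℂ fun n => (Real.sqrt n : ℂ) • Finsupp.lsingle (n - 1)

/-- The creation operator `a† : D → D`, `a† eₙ = √(n+1) e_{n+1}`. -/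
def adOp : Db →ₗ[ℂ] Db :=
  Finsupp.lsum ℂ fun n => (Real.sqrt (n + 1) : ℂ) • Finsupp.lsingle (n + 1)

/-- The number operator `N = a† a` on `D`. -/
def ND : Db →ₗ[ℂ] Db := adOp ∘ₗ aOp

/-- The projection `Π_l` restricted to `D`. -/
def PiD (l : ℕ) : Db →ₗ[ℂ] Db :=
  Finsupp.lsum ℂ fun n => if n = l then Finsupp.lsingle n else 0

/-- `Q_L = Σ_{l=0}^L Π_l` on `D`. -/
def QD (L : ℕ) : Db →ₗ[ℂ] Db := ∑ l ∈ Finset.range (L + 1), PiD l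

/-- The orthogonal projection `Π_l` of `H` onto `ℂ e_l`. -/
def PiH (l : ℕ) : Hb →L[ℂ] Hb := (innerSL ℂ (eb l)).smulRight (eb l)

/-- `Q_L = Σ_{l=0}^L Π_l` on `H`. -/
def QH (L : ℕ) : Hb →L[ℂ] Hb := ∑ l ∈ Finset.range (L + 1), PiH l

/-- For a linear map `T : D → H`, the bounded operator `Π_l T Π_s` on `H`
(it is `x ↦ ⟪e_s, x⟫ • Π_l (T e_s)`, of rank at most one). -/
def sandwich (T : Db →ₗ[ℂ] Hb) (l s : ℕ) : Hb →L[ℂ] Hb :=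
  (innerSL ℂ (eb s)).smulRight (PiH l (T (Finsupp.single s 1)))

/-- Membership in the set `𝒞` of positive, bounded, continuous functions on `[0,∞)`
decreasing faster than any inverse power. -/
structure IsC (f : ℝ → ℝ) : Prop where
  cont : ContinuousOn f (Set.Ici (0 : ℝ))
  bdd : ∃ B : ℝ, ∀ x ∈ Set.Ici (0 : ℝ), f x ≤ B
  pos : ∀ x ∈ Set.Ici (0 : ℝ), 0 < f x
  decay : ∀ n : ℕ, Tendsto (fun x : ℝ => x ^ n * f x) atTop (nhds 0)

/-- The seminorm `p_{f,k}(T) = Σ_{l,s} f(l) s^k ‖Π_l T Π_s‖ ∈ [0,∞]`. -/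
def semin (f : ℝ → ℝ) (k : ℕ) (T : Db →ₗ[ℂ] Hb) : ℝ≥0∞ :=
  ∑' (l : ℕ) (s : ℕ), ENNReal.ofReal (f l * (s : ℝ) ^ k * ‖sandwich T l s‖)

end

noncomputable section

/-- Iterated commutator of linear maps on `D`: `[X,Y]₀ = Y`, `[X,Y]ₘ = X[X,Y]_{m-1} - [X,Y]_{m-1}X`. -/
def itComm (X Y : Db →ₗ[ℂ] Db) : ℕ → Db →ₗ[ℂ] Db
  | 0 => Y
  | m + 1 => X * itComm X Y m - itComm X Y m * X

/-- The complex square root `√n` of a natural number. -/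
def natSqrt (n : ℕ) : ℂ := (Real.sqrt n : ℂ)

theorem natSqrt_mul_self (n : ℕ) : natSqrt n * natSqrt n = n := by
  rw [natSqrt, ← Complex.ofReal_mul, Real.mul_self_sqrt (by positivity)]
  rfl

theorem natSqrt_zero : natSqrt 0 = 0 := by simp [natSqrt]

theorem aOp_single (n : ℕ) (c : ℂ) :
    aOp (Finsupp.single n c) = natSqrt n • Finsupp.single (n - 1) c := by
  simp [aOp, natSqrt]

theorem adOp_single (n : ℕ) (c : ℂ) :
    adOp (Finsupp.single n c) = natSqrt (n + 1) • Finsupp.single (n + 1) c := by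
  simp [adOp, natSqrt]

theorem PiD_single (l n : ℕ) (c : ℂ) :
    PiD l (Finsupp.single n c) = if n = l then Finsupp.single n c else 0 := by
  by_cases h : n = l <;> simp [PiD, h]

theorem QD_single (L n : ℕ) (c : ℂ) :
    QD L (Finsupp.single n c) = if n ≤ L then Finsupp.single n c else 0 := by
  simp [QD, PiD_single]

/-- The first commutator of the regularized interaction with `a`. -/
theorem commutator_aOp (K : ℕ) :
    (aOp * QD (K + 1) + adOp * QD K) * aOp - aOp * (aOp * QD (K + 1) + adOp * QD K)
      = aOp ^ 2 * PiD (K + 2) + aOp * adOp * PiD (K + 1) - QD (K + 1) := by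
  refine Finsupp.lhom_ext fun n c => ?_
  have h0 := natSqrt_mul_self n
  have h1 := natSqrt_mul_self (n + 1)
  obtain h | rfl | rfl | h : n ≤ K ∨ n = K + 1 ∨ n = K + 2 ∨ K + 3 ≤ n := by omega
  · rcases n with _ | n
    · simp [aOp_single, adOp_single, QD_single, PiD_single, natSqrt_zero, smul_smul, h1,
        -Finsupp.smul_single]
    · have e6 : n ≤ K := by omega
      have e7 : n ≤ K + 1 := by omega
      have e8 : n ≠ K := by omega
      have e9 : n ≠ K + 1 := by omega
      simp [aOp_single, adOp_single, QD_single, PiD_single, h, e6, e7, e8, e9, smul_smul,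
        -Finsupp.smul_single]
      push_cast at h0 h1
      match_scalars
      linear_combination h0 - h1
  · simp [aOp_single, adOp_single, QD_single, PiD_single, pow_two, smul_smul,
      -Finsupp.smul_single]
    push_cast at h0 h1
    match_scalars
    linear_combination h0 - h1
  · simp [aOp_single, QD_single, PiD_single, pow_two, smul_smul, -Finsupp.smul_single]
  · have e1 : ¬ n ≤ K + 1 := by omega
    have e2 : ¬ n - 1 ≤ K + 1 := by omega
    have e3 : ¬ n - 1 ≤ K := by omega
    have e4 : n ≠ K + 1 := by omega
    have e5 : n ≠ K + 2 := by omega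
    have e6 : ¬ n ≤ K := by omega
    simp [aOp_single, QD_single, PiD_single, e1, e2, e3, e4, e5, e6,
      -Finsupp.smul_single, -tsub_le_iff_right]

/-- The second commutator of the regularized interaction with `a`. -/
theorem commutator_commutator_aOp (K : ℕ) :
    (aOp * QD (K + 1) + adOp * QD K) *
          (aOp ^ 2 * PiD (K + 2) + aOp * adOp * PiD (K + 1) - QD (K + 1))
        - (aOp ^ 2 * PiD (K + 2) + aOp * adOp * PiD (K + 1) - QD (K + 1)) *
          (aOp * QD (K + 1) + adOp * QD K)
      = aOp ^ 3 * PiD (K + 2) + aOp ^ 2 * adOp * (PiD (K + 1) + PiD (K + 2))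
        - 2 • (aOp * PiD (K + 2)) - aOp * adOp ^ 2 * PiD K := by
  refine Finsupp.lhom_ext fun n c => ?_
  obtain h | rfl | rfl | rfl | h :
      n < K ∨ n = K ∨ n = K + 1 ∨ n = K + 2 ∨ K + 3 ≤ n := by omega
  · have e1 : n ≤ K + 1 := by omega
    have e2 : n - 1 ≤ K + 1 := by omega
    have e4 : n ≠ K + 1 := by omega
    have e5 : n ≠ K + 2 := by omega
    have e6 : n ≤ K := by omega
    have e7 : n ≠ K := by omega
    have e8 : n - 1 ≠ K + 1 := by omega
    have e9 : n - 1 ≠ K + 2 := by omega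
    simp [aOp_single, adOp_single, QD_single, PiD_single, e1, e2, e4, e5, e6, e7, e8, e9,
      -Finsupp.smul_single, -tsub_le_iff_right]
    abel
  · have e2 : n - 1 ≤ n + 1 := by omega
    have e8 : n - 1 ≠ n + 1 := by omega
    have e9 : n - 1 ≠ n + 2 := by omega
    simp [aOp_single, adOp_single, QD_single, PiD_single, e2, e8, e9, pow_succ, smul_smul,
      -Finsupp.smul_single, -tsub_le_iff_right]
    match_scalars <;> ring
  · simp [aOp_single, adOp_single, QD_single, PiD_single, pow_succ, smul_smul,
      -Finsupp.smul_single]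
    match_scalars
    ring
  · simp [aOp_single, adOp_single, QD_single, PiD_single, pow_succ, smul_smul,
      -Finsupp.smul_single]
    have h1 := natSqrt_mul_self (K + 1)
    have h3 := natSqrt_mul_self (K + 2 + 1)
    push_cast at h1 h3
    match_scalars
    · ring
    · linear_combination natSqrt (K + 2) * (h1 - h3)
  · have e1 : ¬ n ≤ K + 1 := by omega
    have e4 : n ≠ K + 1 := by omega
    have e5 : n ≠ K + 2 := by omega
    have e6 : ¬ n ≤ K := by omega
    have e7 : n ≠ K := by omega
    simp [QD_single, PiD_single, e1, e4, e5, e6, e7]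

/-- for every `L ≥ 1`, with `X_L = a Q_L + a† Q_{L-1}`,
`[X_L, a]₁ = a² Π_{L+1} + a a† Π_L - Q_L` and
`[X_L, a]₂ = a³ Π_{L+1} + a² a† (Π_L + Π_{L+1}) - 2 a Π_{L+1} - a (a†)² Π_{L-1}`
as linear maps on `D`. -/
theorem stmt14 (L : ℕ) (hL : 1 ≤ L) :
    itComm (aOp * QD L + adOp * QD (L - 1)) aOp 1
      = aOp ^ 2 * PiD (L + 1) + aOp * adOp * PiD L - QD L ∧
    itComm (aOp * QD L + adOp * QD (L - 1)) aOp 2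
      = aOp ^ 3 * PiD (L + 1) + aOp ^ 2 * adOp * (PiD L + PiD (L + 1))
        - 2 • (aOp * PiD (L + 1)) - aOp * adOp ^ 2 * PiD (L - 1) := by
  obtain ⟨K, rfl⟩ : ∃ K, L = K + 1 := ⟨L - 1, by omega⟩
  have h1 : itComm (aOp * QD (K + 1) + adOp * QD K) aOp 1
      = aOp ^ 2 * PiD (K + 2) + aOp * adOp * PiD (K + 1) - QD (K + 1) :=
    commutator_aOp K
  refine ⟨h1, ?_⟩
  rw [itComm, Nat.add_sub_cancel, h1]
  exact commutator_commutator_aOp K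

end
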